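/- In the discriminant group A_M ≅ (Z/2Z)^4 of the lattice M, the only nontrivial isotropic elements for the induced quadratic form q_M (with values in Q/2Z) are the five classes f_i* = [f_i/2], where f_i = h - e_i. In particular A_M contains exactly 5 nontrivial isotropic elements. -/

import Mathlib

open Matrix BigOperators

/-- Gram matrix of the rank 6 lattice `M` with basis `l', e₁, …, e₅`:
`l'² = eᵢ² = -2`, `l'·eᵢ = 1`, `eᵢ·eⱼ = 0` for `i ≠ j`.
Index `0` corresponds to `l'` and index `i.succ` to `eᵢ`. -/
def Mgram : Matrix (Fin 6) (Fin 6) ℤ :=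
  fun i j => if i = j then -2 else if i = 0 ∨ j = 0 then 1 else 0

/-- The bilinear form of the lattice `M`. -/
def bM (x y : Fin 6 → ℤ) : ℤ := x ⬝ᵥ (Mgram.mulVec y)

/-- The basis vector `l'`. -/
def lvec : Fin 6 → ℤ := fun j => if j = 0 then 1 else 0

/-- The basis vector `eᵢ`. -/
def ev (i : Fin 5) : Fin 6 → ℤ := fun j => if j = i.succ then 1 else 0

/-- The element `h = 2l' + e₁ + ⋯ + e₅`. -/
def hv : Fin 6 → ℤ := fun j => if j = 0 then 2 else 1

/-- The ℚ-valued bilinear form attached to an integral Gram matrix `A`. -/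
def gq {n : ℕ} (A : Matrix (Fin n) (Fin n) ℤ) (y z : Fin n → ℚ) : ℚ :=
  y ⬝ᵥ ((A.map (Int.cast : ℤ → ℚ)).mulVec z)

lemma gq_add_left {n : ℕ} (A : Matrix (Fin n) (Fin n) ℤ) (y y' z : Fin n → ℚ) :
    gq A (y + y') z = gq A y z + gq A y' z := by
  simp [gq, add_dotProduct]

lemma gq_zsmul_left {n : ℕ} (A : Matrix (Fin n) (Fin n) ℤ) (c : ℤ) (y z : Fin n → ℚ) :
    gq A (c • y) z = (c : ℚ) * gq A y z := by
  rw [gq, smul_dotProduct, zsmul_eq_mul]; rfl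

/-- The dual lattice `L* = {y ∈ L ⊗ ℚ : y·x ∈ ℤ for all x ∈ L}` of the lattice
with Gram matrix `A`, as a ℤ-submodule of `ℚⁿ`. -/
def dualL {n : ℕ} (A : Matrix (Fin n) (Fin n) ℤ) : Submodule ℤ (Fin n → ℚ) where
  carrier := {y | ∀ x : Fin n → ℤ, ∃ m : ℤ, gq A y (fun i => (x i : ℚ)) = (m : ℚ)}
  add_mem' := by
    intro a b ha hb x
    obtain ⟨m1, h1⟩ := ha x
    obtain ⟨m2, h2⟩ := hb x
    exact ⟨m1 + m2, by rw [gq_add_left, h1, h2]; push_cast; ring⟩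
  zero_mem' := by
    intro x
    exact ⟨0, by simp [gq]⟩
  smul_mem' := by
    intro c a ha x
    obtain ⟨m, h⟩ := ha x
    exact ⟨c * m, by rw [gq_zsmul_left, h]; push_cast; ring⟩

/-- The lattice `L = ℤⁿ` sitting inside `ℚⁿ` (spanned by the standard basis). -/
def stdL (n : ℕ) : Submodule ℤ (Fin n → ℚ) :=
  Submodule.span ℤ (Set.range fun i : Fin n => fun j => if j = i then (1 : ℚ) else 0)

/-- The discriminant group `A_L = L*/L` of the lattice with Gram matrix `A`. -/
abbrev discG {n : ℕ} (A : Matrix (Fin n) (Fin n) ℤ) :=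
  (dualL A) ⧸ (Submodule.comap (dualL A).subtype (stdL n))

/-- The discriminant group of `M`. -/
abbrev AM := discG Mgram

/-- The vector `fᵢ/2 = (h - eᵢ)/2 ∈ M ⊗ ℚ`, a representative of the class
`fᵢ* ∈ A_M`. -/
def fhalf (i : Fin 5) : Fin 6 → ℚ :=
  fun j => ((hv j - ev i j : ℤ) : ℚ) / 2

/-- An element of `A_M` is isotropic for the induced quadratic form
`q_M : A_M → ℚ/2ℤ` if it has a representative `y ∈ M*` with `y·y ∈ 2ℤ`. -/
def IsIsotropic (a : AM) : Prop :=
  ∃ y : dualL Mgram, Submodule.Quotient.mk y = a ∧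
    ∃ m : ℤ, gq Mgram (y : Fin 6 → ℚ) (y : Fin 6 → ℚ) = 2 * m

/-- `a` is the class `fᵢ* = [fᵢ/2]` in `A_M`. -/
def IsFClass (i : Fin 5) (a : AM) : Prop :=
  ∃ y : dualL Mgram, (y : Fin 6 → ℚ) = fhalf i ∧ Submodule.Quotient.mk y = a

lemma mem_stdL_iff {n : ℕ} {y : Fin n → ℚ} :
    y ∈ stdL n ↔ ∃ x : Fin n → ℤ, ∀ i, y i = x i := by
  constructor
  · intro hy
    induction hy using Submodule.span_induction with
    | mem _ hx =>
      obtain ⟨i, rfl⟩ := hx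
      exact ⟨fun j => if j = i then 1 else 0, fun j => by push_cast; rfl⟩
    | zero => exact ⟨0, fun i => by simp⟩
    | add _ _ _ _ hu hv =>
      obtain ⟨u, hu⟩ := hu
      obtain ⟨v, hv⟩ := hv
      exact ⟨u + v, fun i => by simp [hu, hv]⟩
    | smul c _ _ hu =>
      obtain ⟨u, hu⟩ := hu
      exact ⟨c • u, fun i => by simp [hu]⟩
  · rintro ⟨x, hx⟩
    have h : y = ∑ i, x i • fun j : Fin n => if j = i then (1 : ℚ) else 0 := by
      ext j
      simp [hx, Finset.sum_apply]
    rw [h]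
    exact Submodule.sum_mem _ fun i _ =>
      Submodule.smul_mem _ _ (Submodule.subset_span ⟨i, rfl⟩)

lemma gq_Mgram (y z : Fin 6 → ℚ) :
    gq Mgram y z = y 0 * (-2 * z 0 + (z 1 + z 2 + z 3 + z 4 + z 5)) + y 1 * (z 0 - 2 * z 1) +
      y 2 * (z 0 - 2 * z 2) + y 3 * (z 0 - 2 * z 3) + y 4 * (z 0 - 2 * z 4) +
      y 5 * (z 0 - 2 * z 5) := by
  simp [gq, Mgram, dotProduct, Matrix.mulVec, Fin.sum_univ_succ]
  ring

/-- An element of `M*` has integral `l'`-coordinate and half-integral `eᵢ`-coordinates `cᵢ/2`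
with `∑ cᵢ` even. -/
lemma exists_coords_of_mem_dualL {y : Fin 6 → ℚ} (hy : y ∈ dualL Mgram) :
    ∃ (a s : ℤ) (c : Fin 5 → ℤ), y 0 = a ∧ (∀ i, y i.succ = c i / 2) ∧
      c 0 + c 1 + c 2 + c 3 + c 4 = 2 * s := by
  have he (i : Fin 5) : ∃ m : ℤ, y 0 - 2 * y i.succ = m := by
    obtain ⟨m, hm⟩ := hy (ev i)
    refine ⟨m, hm ▸ ?_⟩
    rw [gq_Mgram]
    fin_cases i <;> simp [ev] <;> ring
  obtain ⟨m, hm⟩ := hy lvec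
  rw [gq_Mgram] at hm
  simp [lvec] at hm
  choose n hn using he
  have h0 := hn 0
  have h1 := hn 1
  have h2 := hn 2
  have h3 := hn 3
  have h4 := hn 4
  simp only [Fin.reduceSucc, Fin.succ_zero_eq_one] at h0 h1 h2 h3 h4
  have ha : y 0 = ((2 * m + n 0 + n 1 + n 2 + n 3 + n 4 : ℤ) : ℚ) := by
    push_cast
    linarith
  refine ⟨_, 2 * (2 * m + n 0 + n 1 + n 2 + n 3 + n 4) + m,
    fun i => 2 * m + n 0 + n 1 + n 2 + n 3 + n 4 - n i, ha, fun i => ?_, by ring⟩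
  have := hn i
  push_cast at ha ⊢
  linarith

lemma fhalf_mem_dualL (i : Fin 5) : fhalf i ∈ dualL Mgram := by
  intro x
  refine ⟨x (i.succ), ?_⟩
  rw [gq_Mgram]
  fin_cases i <;> simp [fhalf, hv, ev] <;> ring

lemma gq_fhalf_self (i : Fin 5) : gq Mgram (fhalf i) (fhalf i) = 0 := by
  rw [gq_Mgram]
  fin_cases i <;> simp [fhalf, hv, ev] <;> norm_num

/-- Among five integers with even sum and sum of squares divisible by `4`, none or exactly four
are odd. -/
lemma even_or_exists_of_sum_sq {c : Fin 5 → ℤ} {k : ℤ}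
    (h : c 0 ^ 2 + c 1 ^ 2 + c 2 ^ 2 + c 3 ^ 2 + c 4 ^ 2 = 4 * k) :
    (∀ i, c i % 2 = 0) ∨ ∃ i, ∀ j, c j % 2 = if j = i then 0 else 1 := by
  have key (z : ℤ) : z ^ 2 % 4 = z % 2 := by
    rcases Int.even_or_odd' z with ⟨t, rfl | rfl⟩ <;> ring_nf <;> omega
  have parity : ∀ p : Fin 5 → Bool, 4 ∣ ∑ i, (p i).toNat →
      (∀ i, p i = false) ∨ ∃ i, ∀ j, p j = !decide (j = i) := by decide
  have toNat (i : Fin 5) : ((decide (c i % 2 = 1)).toNat : ℤ) = c i % 2 := by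
    rcases Int.emod_two_eq_zero_or_one (c i) with hi | hi <;> simp [hi]
  have hdvd : 4 ∣ ∑ i, (decide (c i % 2 = 1)).toNat := by
    rw [← Int.natCast_dvd_natCast]
    push_cast
    simp only [toNat, Fin.sum_univ_five]
    have k0 := key (c 0)
    have k1 := key (c 1)
    have k2 := key (c 2)
    have k3 := key (c 3)
    have k4 := key (c 4)
    omega
  refine (parity _ hdvd).imp (fun h i => ?_) fun ⟨i, h⟩ => ⟨i, fun j => ?_⟩
  · have := h i
    simp at this
    omega
  · have := h j
    split_ifs with hji <;> simp [hji] at this <;> simp_all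

/-- The only nontrivial isotropic elements of `A_M ≅ (ℤ/2)⁴` are the five
classes `fᵢ* = [fᵢ/2]`, `fᵢ = h - eᵢ`; in particular `A_M` contains exactly
`5` nontrivial isotropic elements. -/
theorem isotropic_elements_of_AM :
    (∀ a : AM, a ≠ 0 → (IsIsotropic a ↔ ∃ i : Fin 5, IsFClass i a)) ∧
    (∃ F : Fin 5 → AM, (∀ i, IsFClass i (F i)) ∧
      Function.Injective F ∧ ∀ i, F i ≠ 0) := by
  have hF (i : Fin 5) : IsFClass i (Submodule.Quotient.mk ⟨fhalf i, fhalf_mem_dualL i⟩) :=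
    ⟨_, rfl, rfl⟩
  refine ⟨fun a ha => ⟨?_, ?_⟩, _, hF, fun i j hij => ?_, fun i hi => ?_⟩
  · rintro ⟨⟨y, hy⟩, rfl, m, hm⟩
    rw [Ne, Submodule.Quotient.mk_eq_zero, Submodule.mem_comap, mem_stdL_iff] at ha
    obtain ⟨a, s, c, h0, hc, hs⟩ := exists_coords_of_mem_dualL hy
    have hsq : c 0 ^ 2 + c 1 ^ 2 + c 2 ^ 2 + c 3 ^ 2 + c 4 ^ 2 = 4 * (a * s - a ^ 2 - m) := by
      have c0 := hc 0
      have c1 := hc 1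
      have c2 := hc 2
      have c3 := hc 3
      have c4 := hc 4
      simp only [Fin.reduceSucc, Fin.succ_zero_eq_one] at c0 c1 c2 c3 c4
      simp only [gq_Mgram, h0, c0, c1, c2, c3, c4] at hm
      have hs' : (c 0 + c 1 + c 2 + c 3 + c 4 : ℚ) = 2 * s := mod_cast hs
      have : (c 0 ^ 2 + c 1 ^ 2 + c 2 ^ 2 + c 3 ^ 2 + c 4 ^ 2 : ℚ) = 4 * (a * s - a ^ 2 - m) := by
        linear_combination -2 * hm + 2 * a * hs'
      exact_mod_cast this
    rcases even_or_exists_of_sum_sq hsq with h | ⟨i, h⟩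
    · refine absurd ⟨Fin.cons a fun i => c i / 2, fun j => ?_⟩ ha
      refine Fin.cases (by simpa using h0) (fun i => ?_) j
      have : (c i : ℚ) = 2 * (c i / 2 : ℤ) := by
        have := h i
        exact_mod_cast (by omega : c i = 2 * (c i / 2))
      simp only [Submodule.subtype_apply, hc, Fin.cons_succ]
      linarith
    · refine ⟨i, ⟨fhalf i, fhalf_mem_dualL i⟩, rfl, ?_⟩
      rw [eq_comm, Submodule.Quotient.eq, Submodule.mem_comap, mem_stdL_iff]
      refine ⟨Fin.cons (a - 1) fun i => c i / 2, fun j => ?_⟩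
      refine Fin.cases (by simp [h0, fhalf, hv, ev, (Fin.succ_ne_zero i).symm]) (fun j => ?_) j
      have : (c j : ℚ) = 2 * (c j / 2 : ℤ) + if j = i then 0 else 1 := by
        have := h j
        have h2 : c j = 2 * (c j / 2) + if j = i then 0 else 1 := by omega
        exact_mod_cast h2
      simp only [Submodule.subtype_apply, AddSubgroupClass.coe_sub, Pi.sub_apply, hc,
        Fin.cons_succ, fhalf, hv, ev, Fin.succ_inj, Fin.succ_ne_zero, if_false]
      split_ifs at this ⊢ <;> push_cast <;> linarith
  · rintro ⟨i, ⟨y, hy⟩, rfl, rfl⟩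
    exact ⟨_, rfl, 0, by simp [gq_fhalf_self]⟩
  · rw [Submodule.Quotient.eq, Submodule.mem_comap, mem_stdL_iff] at hij
    obtain ⟨x, hx⟩ := hij
    by_contra hne
    have h := hx i.succ
    simp [fhalf, hv, ev, hne] at h
    field_simp at h
    norm_cast at h
    omega
  · rw [Submodule.Quotient.mk_eq_zero, Submodule.mem_comap, mem_stdL_iff] at hi
    obtain ⟨x, hx⟩ := hi
    have h := hx (i + 1).succ
    simp [fhalf, hv, ev] at h
    field_simp at h
    norm_cast at h
    omega
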